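/- arXiv:1809.08169 — 3 statements merged into one kernel-verified Lean document; each statement's English description precedes it below -/
import Mathlib

section
/- For each intersection type A there exists a natural number n such that every closed lambda term M in beta normal form with ⊢ M : A derivable in BCD has class n. -/
/-! Common definitions: untyped lambda calculus (de Bruijn), beta/eta reduction,
BCD intersection types, derivations, Böhm-tree notions, numeral systems. -/

inductive Term : Type
  | var : ℕ → Term
  | app : Term → Term → Term
  | lam : Term → Term
  deriving DecidableEq

namespace Term

/-- Lift the free variables `≥ k` by `d`. -/
def lift (d : ℕ) : ℕ → Term → Term
  | k, var n => if n < k then var n else var (n + d)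
  | k, app s t => app (lift d k s) (lift d k t)
  | k, lam t => lam (lift d (k + 1) t)

/-- Substitute `u` for the free variable `k`. -/
def subst (u : Term) : ℕ → Term → Term
  | k, var n => if n = k then lift k 0 u else if k < n then var (n - 1) else var n
  | k, app s t => app (subst u k s) (subst u k t)
  | k, lam t => lam (subst u (k + 1) t)

/-- One-step beta reduction. -/
inductive Beta : Term → Term → Prop
  | beta (t u : Term) : Beta (app (lam t) u) (subst u 0 t)
  | appL {s s' : Term} (t : Term) : Beta s s' → Beta (app s t) (app s' t)
  | appR (s : Term) {t t' : Term} : Beta t t' → Beta (app s t) (app s t')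
  | lam {t t' : Term} : Beta t t' → Beta (lam t) (lam t')

/-- One-step eta reduction. -/
inductive Eta : Term → Term → Prop
  | eta (t : Term) : Eta (lam (app (lift 1 0 t) (var 0))) t
  | appL {s s' : Term} (t : Term) : Eta s s' → Eta (app s t) (app s' t)
  | appR (s : Term) {t t' : Term} : Eta t t' → Eta (app s t) (app s t')
  | lam {t t' : Term} : Eta t t' → Eta (lam t) (lam t')

/-- One-step beta-eta reduction. -/
def BetaEta (s t : Term) : Prop := Beta s t ∨ Eta s t

/-- Beta-eta conversion. -/
inductive Conv : Term → Term → Prop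
  | rel {s t : Term} : BetaEta s t → Conv s t
  | refl (t : Term) : Conv t t
  | symm {s t : Term} : Conv s t → Conv t s
  | trans {s t u : Term} : Conv s t → Conv t u → Conv s u

/-- Beta conversion. -/
inductive BetaConv : Term → Term → Prop
  | rel {s t : Term} : Beta s t → BetaConv s t
  | refl (t : Term) : BetaConv t t
  | symm {s t : Term} : BetaConv s t → BetaConv t s
  | trans {s t u : Term} : BetaConv s t → BetaConv t u → BetaConv s u

/-- Beta normal form. -/
def BetaNormal (t : Term) : Prop := ∀ u, ¬ Beta t u

/-- Beta-eta normal form. -/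
def BetaEtaNormal (t : Term) : Prop := ∀ u, ¬ BetaEta t u

/-- Strongly normalizable (with respect to beta reduction). -/
def SN (t : Term) : Prop := Acc (fun a b => Beta b a) t

/-- All free variables are `< k`. -/
def ClosedUnder : ℕ → Term → Prop
  | k, var n => n < k
  | k, app s t => ClosedUnder k s ∧ ClosedUnder k t
  | k, lam t => ClosedUnder (k + 1) t

/-- Closed term. -/
def Closed (t : Term) : Prop := ClosedUnder 0 t

/-- Length of the outermost lambda prefix. -/
def prefixLen : Term → ℕ
  | lam t => prefixLen t + 1
  | _ => 0

/-- Strip the outermost lambda prefix. -/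
def stripPrefix : Term → Term
  | lam t => stripPrefix t
  | t => t

/-- Head variable of an application spine. -/
def spineHead : Term → Option ℕ
  | var n => some n
  | app s _ => spineHead s
  | lam _ => none

/-- Arguments of an application spine. -/
def spineArgs : Term → List Term
  | app s t => spineArgs s ++ [t]
  | _ => []

/-- Head variable of a Böhm-tree node `λ x_1 ... x_k. x t_1 ... t_l`. -/
def headOf (t : Term) : Option ℕ := spineHead (stripPrefix t)

/-- Immediate descendants (the arguments) of a Böhm-tree node. -/
def argsOf (t : Term) : List Term := spineArgs (stripPrefix t)

/-- `Desc t d w` : `w` is a node of the Böhm tree of the beta-normal term `t`;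
`d` is the number of lambdas crossed strictly above (the root of) `w`. -/
inductive Desc : Term → ℕ → Term → Prop
  | refl (t : Term) : Desc t 0 t
  | step {t u w : Term} {d : ℕ} : u ∈ argsOf t → Desc u d w →
      Desc t (prefixLen t + d) w

/-- `Osc t l` : the Böhm tree of the beta-normal term `t` contains an oscillation
of length `l` whose first pair has the root of `t` as its first coordinate:
a node `λ x⃗.x` is paired with one of the arguments `u` of this occurrence of `x`
having a non-empty lambda prefix, and the next pair (if it exists) has the head
variable of its first coordinate `w` bound by the lambda prefix of `u`. -/
inductive Osc : Term → ℕ → Prop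
  | one {t u : Term} : u ∈ argsOf t → 0 < prefixLen u → Osc t 1
  | succ {t u w : Term} {d h l : ℕ} : u ∈ argsOf t → 0 < prefixLen u →
      Desc u d w → headOf w = some h →
      prefixLen w + d ≤ h + prefixLen u → h < prefixLen w + d →
      Osc w l → Osc t (l + 1)

/-- `X` has class `n` : every lambda prefix in the Böhm tree of `X` has at most `n`
lambdas, every node has at most `n` immediate descendants, and every oscillation
has length at most `n`. -/
def HasClass (n : ℕ) (X : Term) : Prop :=
  (∀ d w, Desc X d w → prefixLen w ≤ n ∧ (argsOf w).length ≤ n) ∧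
  (∀ d w l, Desc X d w → Osc w l → l ≤ n)

/-- Depth of the Böhm tree of a beta-normal term. -/
def tdepth : Term → ℕ
  | var _ => 0
  | lam t => tdepth t
  | app s t => max (tdepth s) (tdepth t + 1)

end Term

/-- `iterApp f n x = f (f ( ... (f x)))`, `n` times. -/
def iterApp (f : Term) : ℕ → Term → Term
  | 0, x => x
  | n + 1, x => Term.app f (iterApp f n x)

/-- Church numeral. -/
def church (n : ℕ) : Term := Term.lam (Term.lam (iterApp (Term.var 1) n (Term.var 0)))

/-- A fixed effective Gödel numbering of lambda terms. -/
def gnum : Term → ℕ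
  | Term.var n => Nat.pair 0 n
  | Term.app s t => Nat.pair 1 (Nat.pair (gnum s) (gnum t))
  | Term.lam t => Nat.pair 2 (gnum t)

/-- Intersection types (no top element). -/
inductive Ty : Type
  | atom : ℕ → Ty
  | arrow : Ty → Ty → Ty
  | inter : Ty → Ty → Ty
  deriving DecidableEq

namespace Ty

/-- The subtype preorder on intersection types (the "Traditional" system). -/
inductive Sub : Ty → Ty → Prop
  | refl (A : Ty) : Sub A A
  | trans {A B C : Ty} : Sub A B → Sub B C → Sub A C
  | interL (A B : Ty) : Sub (inter A B) A
  | interR (A B : Ty) : Sub (inter A B) B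
  | interGlb {C A B : Ty} : Sub C A → Sub C B → Sub C (inter A B)
  | arrow {A B C D : Ty} : Sub A C → Sub D B → Sub (arrow C D) (arrow A B)
  | dist (A B C : Ty) : Sub (inter (arrow A B) (arrow A C)) (arrow A (inter B C))

def IsInter : Ty → Prop
  | inter _ _ => True
  | _ => False

/-- Dist normal form: no subexpression of the shape `A → (B ∧ C)`. -/
def Dnf : Ty → Prop
  | atom _ => True
  | arrow A B => Dnf A ∧ Dnf B ∧ ¬ IsInter B
  | inter A B => Dnf A ∧ Dnf B

/-- `occ a s A` : the number of occurrences of the atom `a` in `A` whose sign is `s`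
(`true` = positive, `false` = negative); signs are preserved in the right argument
of `→` and in both arguments of `∧`, and flipped in the left argument of `→`. -/
def occ (a : ℕ) : Bool → Ty → ℕ
  | s, atom b => if s then (if a = b then 1 else 0) else 0
  | s, arrow C B => occ a (!s) C + occ a s B
  | s, inter C B => occ a s C + occ a s B

/-- `interOcc s A` : the number of occurrences of `∧` in `A` with sign `s`. -/
def interOcc : Bool → Ty → ℕ
  | _, atom _ => 0
  | s, arrow C B => interOcc (!s) C + interOcc s B
  | s, inter C B => (if s then 1 else 0) + interOcc s C + interOcc s B

/-- A type in dnf is functional if each atom occurs at most twice, any two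
occurrences of the same atom have opposite sign, and `∧` has no positive
occurrence. -/
def Functional (A : Ty) : Prop :=
  Dnf A ∧ (∀ a, occ a true A ≤ 1 ∧ occ a false A ≤ 1) ∧ interOcc true A = 0

/-- Co-functional: as `Functional` but `∧` has no negative occurrence. -/
def CoFunctional (A : Ty) : Prop :=
  Dnf A ∧ (∀ a, occ a true A ≤ 1 ∧ occ a false A ≤ 1) ∧ interOcc false A = 0

/-- Tropical evaluation of a type at the valuation `v` of the atom variables, at
sign `s`; `te v true A` is `e(A)` and `te v false A` is its dual `~e(A)`. -/
def te (v : ℕ → ℕ) : Bool → Ty → ℕ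
  | _, atom a => v a
  | s, arrow C B => 1 + te v (!s) C + te v s B
  | s, inter C B => if s then min (te v s C) (te v s B) else max (te v s C) (te v s B)

/-- slat congruence : the congruence generated by associativity and commutativity
of `∧` and idempotence `A ~ A ∧ A`. -/
inductive Slat : Ty → Ty → Prop
  | refl (A : Ty) : Slat A A
  | symm {A B : Ty} : Slat A B → Slat B A
  | trans {A B C : Ty} : Slat A B → Slat B C → Slat A C
  | assoc (A B C : Ty) : Slat (inter A (inter B C)) (inter (inter A B) C)
  | comm (A B : Ty) : Slat (inter A B) (inter B A)
  | idem (A : Ty) : Slat A (inter A A)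
  | arrowCong {A A' B B' : Ty} : Slat A A' → Slat B B' → Slat (arrow A B) (arrow A' B')
  | interCong {A A' B B' : Ty} : Slat A A' → Slat B B' → Slat (inter A B) (inter A' B')

/-- The `i`-th argument type along the arrows of a type. -/
def argTy : Ty → ℕ → Option Ty
  | arrow A _, 0 => some A
  | arrow _ B, n + 1 => argTy B n
  | _, _ => none

/-- The principal atoms (the end atoms of the components) of a type in dnf. -/
def principalAtoms : Ty → List ℕ
  | atom a => [a]
  | arrow _ B => principalAtoms B
  | inter A B => principalAtoms A ++ principalAtoms B

/-- All atoms occurring in a type. -/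
def atoms : Ty → List ℕ
  | atom a => [a]
  | arrow A B => atoms A ++ atoms B
  | inter A B => atoms A ++ atoms B

/-- `arrows [A₁, ..., Aₙ] B = A₁ → ( ... (Aₙ → B) ...)`. -/
def arrows (l : List Ty) (b : Ty) : Ty := l.foldr Ty.arrow b

end Ty

/-- One-hole contexts for types. -/
inductive Ctx : Type
  | hole : Ctx
  | arrowL : Ctx → Ty → Ctx
  | arrowR : Ty → Ctx → Ctx
  | interL : Ctx → Ty → Ctx
  | interR : Ty → Ctx → Ctx

namespace Ctx

/-- Fill the hole of a context with a type. -/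
def fill : Ctx → Ty → Ty
  | hole, A => A
  | arrowL C B, A => Ty.arrow (fill C A) B
  | arrowR B C, A => Ty.arrow B (fill C A)
  | interL C B, A => Ty.inter (fill C A) B
  | interR B C, A => Ty.inter B (fill C A)

/-- Sign of the hole of a context (`true` = positive occurrence). -/
def sign : Ctx → Bool
  | hole => true
  | arrowL C _ => !(sign C)
  | arrowR _ C => sign C
  | interL C _ => sign C
  | interR _ C => sign C

/-- The hole is strictly positive: it never passes through the left argument
of an `→`. -/
def strictPos : Ctx → Prop
  | hole => True
  | arrowL _ _ => False
  | arrowR _ C => strictPos C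
  | interL C _ => strictPos C
  | interR _ C => strictPos C

end Ctx

/-- The Munich system for the subtype relation. -/
inductive Munich : Ty → Ty → Prop
  | slat {A B : Ty} : Ty.Slat A B → Munich A B
  | distrib (E D : Ctx) (B C : Ty) : D.strictPos →
      Munich (E.fill (D.fill (Ty.inter B C))) (E.fill (Ty.inter (D.fill B) (D.fill C)))
  | posElim (E : Ctx) (B C : Ty) : E.sign = true →
      Munich (E.fill (Ty.inter B C)) (E.fill B)
  | negIntro (E : Ctx) (B C : Ty) : E.sign = false →
      Munich (E.fill B) (E.fill (Ty.inter B C))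
  | trans {A B C : Ty} : Munich A B → Munich B C → Munich A C

/-- BCD derivations (as proof trees). A basis is a finite list of types, the
variable `var n` receiving the `n`-th type of the list. -/
inductive Deriv : List Ty → Term → Ty → Type
  | var (Γ : List Ty) (n : ℕ) (A : Ty) : Γ[n]? = some A → Deriv Γ (Term.var n) A
  | lam (Γ : List Ty) (t : Term) (A B : Ty) :
      Deriv (A :: Γ) t B → Deriv Γ (Term.lam t) (Ty.arrow A B)
  | app (Γ : List Ty) (s t : Term) (A B : Ty) :
      Deriv Γ s (Ty.arrow A B) → Deriv Γ t A → Deriv Γ (Term.app s t) B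
  | inter (Γ : List Ty) (t : Term) (A B : Ty) :
      Deriv Γ t A → Deriv Γ t B → Deriv Γ t (Ty.inter A B)
  | sub (Γ : List Ty) (t : Term) (A B : Ty) :
      Deriv Γ t A → Ty.Sub A B → Deriv Γ t B

/-- BCD derivability. -/
def BCD (Γ : List Ty) (t : Term) (A : Ty) : Prop := Nonempty (Deriv Γ t A)

/-- All the types of a basis are in dist normal form. -/
def CtxDnf (Γ : List Ty) : Prop := ∀ B ∈ Γ, Ty.Dnf B

namespace Deriv

/-- Every type expression occurring in the derivation is in dist normal form. -/
def allDnf : {Γ : List Ty} → {t : Term} → {A : Ty} → Deriv Γ t A → Prop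
  | _, _, _, var Γ _ A _ => CtxDnf Γ ∧ Ty.Dnf A
  | _, _, _, lam _ _ A B d => Ty.Dnf (Ty.arrow A B) ∧ allDnf d
  | _, _, _, app _ _ _ _ _ d e => allDnf d ∧ allDnf e
  | _, _, _, inter _ _ _ _ d e => allDnf d ∧ allDnf e
  | _, _, _, sub _ _ _ B d _ => Ty.Dnf B ∧ allDnf d

/-- Every application of the subtyping rule has a variable as its subject. -/
def subOnVar : {Γ : List Ty} → {t : Term} → {A : Ty} → Deriv Γ t A → Prop
  | _, _, _, var _ _ _ _ => True
  | _, _, _, lam _ _ _ _ d => subOnVar d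
  | _, _, _, app _ _ _ _ _ d e => subOnVar d ∧ subOnVar e
  | _, _, _, inter _ _ _ _ d e => subOnVar d ∧ subOnVar e
  | _, _, _, sub _ t _ _ d _ => (∃ n, t = Term.var n) ∧ subOnVar d

/-- `temperate d m` : the derivation contains no intemperate sequence, where `m`
applications are pending above the root of `d`: no subtyping inference may
change an argument type at a position that is subsequently consumed by an
application. -/
def temperate : {Γ : List Ty} → {t : Term} → {A : Ty} → Deriv Γ t A → ℕ → Prop
  | _, _, _, var _ _ _ _, _ => True
  | _, _, _, lam _ _ _ _ d, _ => temperate d 0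
  | _, _, _, app _ _ _ _ _ d e, m => temperate d (m + 1) ∧ temperate e 0
  | _, _, _, inter _ _ _ _ d e, _ => temperate d 0 ∧ temperate e 0
  | _, _, _, sub _ _ A B d _, m =>
      (∀ i < m, Ty.argTy A i = Ty.argTy B i) ∧ temperate d m

/-- Almost minimal derivation. -/
def AM {Γ : List Ty} {t : Term} {A : Ty} (d : Deriv Γ t A) : Prop :=
  allDnf d ∧ subOnVar d ∧ temperate d 0

/-- `avoids d k` : the variable (currently of index) `k` is not used in the
derivation `d`. -/
def avoids : {Γ : List Ty} → {t : Term} → {A : Ty} → Deriv Γ t A → ℕ → Prop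
  | _, _, _, var _ n _ _, k => n ≠ k
  | _, _, _, lam _ _ _ _ d, k => avoids d (k + 1)
  | _, _, _, app _ _ _ _ _ d e, k => avoids d k ∧ avoids e k
  | _, _, _, inter _ _ _ _ d e, k => avoids d k ∧ avoids e k
  | _, _, _, sub _ _ _ _ d _, k => avoids d k

end Deriv

def Kterm : Term := Term.lam (Term.lam (Term.var 1))
def KstarTerm : Term := Term.lam (Term.lam (Term.var 0))

def applyList : Term → List Term → Term
  | M, [] => M
  | M, a :: l => applyList (Term.app M a) l

/-- Solvability of a closed term. -/
def Solvable (M : Term) : Prop :=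
  ∃ args : List Term, Term.Conv (applyList M args) (Term.lam (Term.var 0))

/-- A numeral system: a sequence of closed terms together with a successor `S`
and a zero test `Z`. -/
def NumeralSystem (d : ℕ → Term) : Prop :=
  (∀ n, Term.Closed (d n)) ∧
  ∃ S Z : Term, Term.Closed S ∧ Term.Closed Z ∧
    (∀ n, Term.Conv (Term.app S (d n)) (d (n + 1))) ∧
    Term.Conv (Term.app Z (d 0)) KstarTerm ∧
    (∀ n, 0 < n → Term.Conv (Term.app Z (d n)) Kterm)

/-- Lambda definability of a partial function on a numeral system. -/
def LambdaDefinableOn (d : ℕ → Term) (f : ℕ →. ℕ) : Prop :=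
  ∃ F : Term, Term.Closed F ∧
    (∀ n m, m ∈ f n → Term.Conv (Term.app F (d n)) (d m)) ∧
    (∀ n, ¬ (f n).Dom → ¬ Solvable (Term.app F (d n)))

/-- Adequacy: every partial recursive function is lambda definable on the system. -/
def Adequate (d : ℕ → Term) : Prop :=
  ∀ f : ℕ →. ℕ, Nat.Partrec f → LambdaDefinableOn d f

/-- `FG i r k` builds `f(λ x_{k+1}. f( ... f(λ x_n. x_i) ...))` with `r = n - k`
remaining levels, in the context `f, x_1, ..., x_k`. -/
def FG (i : ℕ) : ℕ → ℕ → Term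
  | 0, k => Term.var (k - i)
  | r + 1, k => Term.app (Term.var k) (Term.lam (FG i r (k + 1)))

/-- `Fterm i n = λ f. f(λ x₁. f(λ x₂. ... f(λ xₙ. x_i) ...))`. -/
def Fterm (i n : ℕ) : Term := Term.lam (FG i n 0)

/-- `X'` is an eta expansion of `X`. -/
def EtaExpandsTo (X X' : Term) : Prop :=
  Relation.ReflTransGen (fun a b => Term.Eta b a) X X'

/-- New normal form (for the parameter `n`): beta normal, every lambda prefix in
the Böhm tree has length `n+1` except the newly introduced eta variables (length
`0`), and every maximal oscillation has length `n+1`. -/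
def NewNF (n : ℕ) (X : Term) : Prop :=
  Term.BetaNormal X ∧
  (∀ d w, Term.Desc X d w → Term.prefixLen w = n + 1 ∨ Term.prefixLen w = 0) ∧
  (∀ d w l, Term.Desc X d w → Term.Osc w l → Term.Osc w (l + 1) ∨ l = n + 1)

/-- Having a beta normal form. -/
def HasBetaNF (M : Term) : Prop :=
  ∃ N, Relation.ReflTransGen Term.Beta M N ∧ Term.BetaNormal N

/-- The map taking a term of `S` to the Gödel number of its beta-eta normal form
is representable. -/
def GodelRepresentable (S : Set Term) : Prop :=
  ∃ M : Term, Term.Closed M ∧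
    ∀ N ∈ S, Term.BetaEtaNormal N → Term.Conv (Term.app M N) (church (gnum N))

/-- The set `S` (closed under beta-eta conversion) forms an adequate numeral
system. -/
def IsAdequateNumeralSystem (S : Set Term) : Prop :=
  ∃ d : ℕ → Term, NumeralSystem d ∧ Adequate d ∧
    (∀ n, d n ∈ S) ∧ (∀ M ∈ S, ∃ n, Term.Conv M (d n)) ∧
    (∀ n m, Term.Conv (d n) (d m) → n = m)

namespace Ty

theorem Sub.te_mono {A B : Ty} (h : Sub A B) (v : ℕ → ℕ) :
    te v true A ≤ te v true B ∧ te v false B ≤ te v false A := by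
  induction h <;>
    (try simp only [te, Bool.not_true, Bool.not_false, if_true, Bool.false_eq_true, if_false]) <;> omega

end Ty

namespace Term

theorem BetaNormal.of_lam {t : Term} (h : BetaNormal (lam t)) : BetaNormal t :=
  fun _ hu => h _ (Beta.lam hu)

theorem BetaNormal.of_app_left {s t : Term} (h : BetaNormal (app s t)) : BetaNormal s :=
  fun _ hu => h _ (Beta.appL t hu)

theorem BetaNormal.of_app_right {s t : Term} (h : BetaNormal (app s t)) : BetaNormal t :=
  fun _ hu => h _ (Beta.appR s hu)

theorem BetaNormal.app_left_ne_lam {s t : Term} (h : BetaNormal (app s t)) (r : Term) :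
    s ≠ lam r := by
  rintro rfl
  exact h _ (Beta.beta r t)

/-- `Bounded G t m c` : the Böhm tree of `t` is controlled by a budget `m`, where the free
variables of `t` carry the budgets `G` and the head variable of the root carries the budget `c`. -/
inductive Bounded : List ℕ → Term → ℕ → ℕ → Prop
  | node {G : List ℕ} {t : Term} {m c : ℕ} (Δ : List ℕ) (h : ℕ) (μ κ : Term → ℕ) :
      Δ.length = prefixLen t → prefixLen t ≤ m → (∀ a ∈ Δ, a < m) →
      headOf t = some h → (Δ ++ G)[h]? = some c → (argsOf t).length ≤ c →
      (∀ u ∈ argsOf t, μ u < c) →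
      (∀ u ∈ argsOf t, Bounded (Δ ++ G) u (μ u) (κ u)) → Bounded G t m c

theorem Bounded.lam {G : List ℕ} {t : Term} {a m m' c : ℕ}
    (hb : Bounded (a :: G) t m c) (hm : 1 + a + m ≤ m') : Bounded G (lam t) m' c := by
  obtain ⟨Δ, h, μ, κ, hlen, hpre, hΔ, hh, hc, hl, hμ, hargs⟩ := hb
  have heq : (Δ ++ [a]) ++ G = Δ ++ a :: G := by simp
  refine ⟨Δ ++ [a], h, μ, κ, ?_, ?_, ?_, hh, heq ▸ hc, hl, hμ, ?_⟩
  · simp [hlen, prefixLen]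
  · simp only [prefixLen]
    omega
  · intro b hb
    rcases List.mem_append.mp hb with hb | hb
    · have := hΔ b hb
      omega
    · have := List.mem_singleton.mp hb
      omega
  · rw [heq]
    exact hargs

theorem Bounded.desc {t w : Term} {d : ℕ} (hd : Desc t d w) {G : List ℕ} {m c : ℕ}
    (hb : Bounded G t m c) :
    ∃ (G₁ G₂ : List ℕ) (h m' c' : ℕ), Bounded G₁ w m' c' ∧ headOf w = some h ∧
      G₂.length = prefixLen w + d ∧ (G₂ ++ G)[h]? = some c' ∧
      ∀ N, m ≤ N → (∀ a ∈ G, a ≤ N) → m' ≤ N ∧ c' ≤ N := by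
  induction hd generalizing G m c with
  | refl t =>
    have hb' := hb
    obtain ⟨Δ, h, μ, κ, hlen, hpre, hΔ, hh, hc, hl, hμ, hargs⟩ := hb
    refine ⟨G, Δ, h, m, c, hb', hh, by simpa using hlen, hc, fun N hm hG => ⟨hm, ?_⟩⟩
    rcases List.mem_append.mp (List.mem_of_getElem? hc) with h' | h'
    · exact ((hΔ _ h').trans_le hm).le
    · exact hG _ h'
  | @step t u w d hu _ ih =>
    obtain ⟨Δ, h, μ, κ, hlen, hpre, hΔ, hh, hc, hl, hμ, hargs⟩ := hb
    obtain ⟨G₁, G₂, h', m', c', hw, hw', hlen', hc', hN⟩ := ih (hargs u hu)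
    refine ⟨G₁, G₂ ++ Δ, h', m', c', hw, hw', by simp [hlen, hlen']; omega,
      by simpa using hc', fun N hm hG => ?_⟩
    have hG' : ∀ a ∈ Δ ++ G, a ≤ N := by
      intro a ha
      rcases List.mem_append.mp ha with ha | ha
      · exact ((hΔ _ ha).trans_le hm).le
      · exact hG _ ha
    exact hN N ((hμ u hu).le.trans (hG' _ (List.mem_of_getElem? hc))) hG'

/-- The head variable of a node has a smaller budget than the root whose prefix binds it. -/
theorem Bounded.desc_bound {u w : Term} {d h : ℕ} (hd : Desc u d w) {G : List ℕ} {m c : ℕ}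
    (hb : Bounded G u m c) (hw : headOf w = some h)
    (h₁ : prefixLen w + d ≤ h + prefixLen u) (h₂ : h < prefixLen w + d) :
    ∃ (G' : List ℕ) (m' c' : ℕ), Bounded G' w m' c' ∧ c' < m := by
  have hb' := hb
  obtain ⟨Δ, k, μ, κ, hlen, hpre, hΔ, hh, hc, hl, hμ, hargs⟩ := hb
  cases hd with
  | refl =>
    obtain rfl : k = h := Option.some.inj (hh.symm.trans hw)
    rw [List.getElem?_append_left (by omega)] at hc
    exact ⟨G, m, c, hb', hΔ _ (List.mem_of_getElem? hc)⟩
  | @step _ u' _ d hu hd =>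
    obtain ⟨G₁, G₂, h', m', c', hbw, hw', hlen', hc', -⟩ := (hargs u' hu).desc hd
    obtain rfl : h' = h := Option.some.inj (hw'.symm.trans hw)
    rw [List.getElem?_append_right (by omega), List.getElem?_append_left (by omega)] at hc'
    exact ⟨G₁, m', c', hbw, hΔ _ (List.mem_of_getElem? hc')⟩

theorem Bounded.osc_le {t : Term} {l : ℕ} (ho : Osc t l) {G : List ℕ} {m c : ℕ}
    (hb : Bounded G t m c) : l ≤ c := by
  induction ho generalizing G m c with
  | one hu _ =>
    obtain ⟨Δ, h, μ, κ, -, -, -, -, -, -, hμ, -⟩ := hb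
    have := hμ _ hu
    omega
  | succ hu _ hd hw h₁ h₂ _ ih =>
    obtain ⟨Δ, h, μ, κ, -, -, -, -, -, -, hμ, hargs⟩ := hb
    obtain ⟨G', m', c', hbw, hlt⟩ := (hargs _ hu).desc_bound hd hw h₁ h₂
    have := hμ _ hu
    have := ih hbw
    omega

theorem Bounded.hasClass {t : Term} {m c : ℕ} (hb : Bounded [] t m c) : HasClass m t := by
  have key : ∀ d w, Desc t d w → ∃ (G : List ℕ) (m' c' : ℕ), Bounded G w m' c' ∧
      m' ≤ m ∧ c' ≤ m := by
    intro d w hd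
    obtain ⟨G, -, -, m', c', hw, -, -, -, hN⟩ := hb.desc hd
    exact ⟨G, m', c', hw, hN m le_rfl (by simp)⟩
  refine ⟨fun d w hd => ?_, fun d w l hd ho => ?_⟩
  · obtain ⟨G, m', c', ⟨Δ, h, μ, κ, -, hpre, -, -, -, hl, -, -⟩, hm, hc⟩ := key d w hd
    exact ⟨hpre.trans hm, hl.trans hc⟩
  · obtain ⟨G, m', c', hw, -, hc⟩ := key d w hd
    exact (hw.osc_le ho).trans hc

end Term

open Term Ty

/-- The spine `t` has a head variable whose budget in `G` pays for the arguments of `t`, with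
`q` left over. -/
def SpineBounded (G : List ℕ) (t : Term) (q : ℕ) : Prop :=
  ∃ h c, spineHead t = some h ∧ G[h]? = some c ∧ (spineArgs t).length + q ≤ c ∧
    ∀ u ∈ spineArgs t, ∃ m k, m < c ∧ Bounded G u m k

theorem SpineBounded.mono {G : List ℕ} {t : Term} {q q' : ℕ} (h : SpineBounded G t q)
    (hq : q' ≤ q) : SpineBounded G t q' := by
  obtain ⟨h, c, hh, hc, hl, hargs⟩ := h
  exact ⟨h, c, hh, hc, by omega, hargs⟩

theorem SpineBounded.bounded {G : List ℕ} {t : Term} {q : ℕ} (hs : SpineBounded G t q)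
    (ht : ∀ r, t ≠ Term.lam r) (m : ℕ) : ∃ c, Bounded G t m c := by
  obtain ⟨h, c, hh, hc, hl, hargs⟩ := hs
  have hstrip : stripPrefix t = t := by
    cases t with
    | lam r => exact absurd rfl (ht r)
    | _ => rfl
  have hpre : prefixLen t = 0 := by
    cases t with
    | lam r => exact absurd rfl (ht r)
    | _ => rfl
  choose! μ κ hμ using hargs
  refine ⟨c, [], h, μ, κ, by simp [hpre], by simp [hpre], by simp, ?_, hc, ?_, ?_, ?_⟩
  · rw [headOf, hstrip, hh]
  all_goals rw [argsOf, hstrip]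
  · omega
  · exact fun u hu => (hμ u hu).1
  · exact fun u hu => (hμ u hu).2

namespace Deriv

variable {v : ℕ → ℕ}

theorem lam_inversion {Γ : List Ty} {t : Term} {A : Ty} (d : Deriv Γ (Term.lam t) A) :
    ∃ B C, BCD (B :: Γ) t C ∧ 1 + te v false B + te v true C ≤ te v true A := by
  generalize hs : Term.lam t = s at d
  induction d with
  | var => cases hs
  | app => cases hs
  | lam Γ t' A B d =>
    cases hs
    exact ⟨A, B, ⟨d⟩, le_rfl⟩
  | inter Γ t' A B _ _ ih₁ ih₂ =>
    simp only [te, if_true]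
    rcases min_choice (te v true A) (te v true B) with h | h <;> rw [h]
    · exact ih₁ hs
    · exact ih₂ hs
  | sub Γ t' A B _ hAB ih =>
    obtain ⟨C, D, h, hle⟩ := ih hs
    exact ⟨C, D, h, hle.trans (hAB.te_mono v).1⟩

theorem var_spineBounded {Γ : List Ty} {n : ℕ} {A : Ty} (d : Deriv Γ (Term.var n) A) :
    SpineBounded (Γ.map (te v false)) (Term.var n) (te v false A) := by
  generalize hs : Term.var n = s at d
  induction d with
  | lam => cases hs
  | app => cases hs
  | var Γ k A hA =>
    exact ⟨k, te v false A, rfl, by simp [hA], by simp [spineArgs], by simp [spineArgs]⟩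
  | inter Γ t' A B _ _ ih₁ ih₂ =>
    rcases max_choice (te v false A) (te v false B) with h | h
    · exact (ih₁ hs).mono (by simp [te, h])
    · exact (ih₂ hs).mono (by simp [te, h])
  | sub Γ t' A B _ hAB ih => exact (ih hs).mono (hAB.te_mono v).2

theorem app_spineBounded {Γ : List Ty} {s t : Term} {A : Ty} (d : Deriv Γ (Term.app s t) A)
    (hs : ∀ B, BCD Γ s B → SpineBounded (Γ.map (te v false)) s (te v false B))
    (ht : ∀ B, BCD Γ t B → ∃ c, Bounded (Γ.map (te v false)) t (te v true B) c) :
    SpineBounded (Γ.map (te v false)) (Term.app s t) (te v false A) := by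
  generalize hr : Term.app s t = r at d
  induction d with
  | lam => cases hr
  | var => cases hr
  | app Γ s t A B d e =>
    cases hr
    obtain ⟨h, c, hh, hc, hl, hargs⟩ := hs _ ⟨d⟩
    obtain ⟨k, hk⟩ := ht _ ⟨e⟩
    simp only [te, Bool.not_false] at hl
    refine ⟨h, c, hh, hc, by simp [spineArgs]; omega, fun u hu => ?_⟩
    rcases List.mem_append.mp hu with hu | hu
    · exact hargs u hu
    · obtain rfl := List.mem_singleton.mp hu
      exact ⟨_, k, by omega, hk⟩
  | inter Γ t' A B _ _ ih₁ ih₂ =>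
    rcases max_choice (te v false A) (te v false B) with h | h
    · exact (ih₁ hs ht hr).mono (by simp [te, h])
    · exact (ih₂ hs ht hr).mono (by simp [te, h])
  | sub Γ t' A B _ hAB ih => exact (ih hs ht hr).mono (hAB.te_mono v).2

end Deriv

theorem BCD.bounded_and_spineBounded (v : ℕ → ℕ) {t : Term} (hn : BetaNormal t) :
    (∀ Γ A, BCD Γ t A → ∃ c, Bounded (Γ.map (te v false)) t (te v true A) c) ∧
    ((∀ r, t ≠ Term.lam r) → ∀ Γ A, BCD Γ t A →
      SpineBounded (Γ.map (te v false)) t (te v false A)) := by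
  induction t with
  | var n =>
    have h : ∀ Γ A, BCD Γ (Term.var n) A →
        SpineBounded (Γ.map (te v false)) (Term.var n) (te v false A) :=
      fun Γ A ⟨d⟩ => d.var_spineBounded
    exact ⟨fun Γ A hd => (h Γ A hd).bounded (by simp) _, fun _ => h⟩
  | app s t ihs iht =>
    have h : ∀ Γ A, BCD Γ (Term.app s t) A →
        SpineBounded (Γ.map (te v false)) (Term.app s t) (te v false A) :=
      fun Γ A ⟨d⟩ => d.app_spineBounded
        ((ihs hn.of_app_left).2 hn.app_left_ne_lam Γ) ((iht hn.of_app_right).1 Γ)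
    exact ⟨fun Γ A hd => (h Γ A hd).bounded (by simp) _, fun _ => h⟩
  | lam t ih =>
    refine ⟨fun Γ A ⟨d⟩ => ?_, fun h => absurd rfl (h t)⟩
    obtain ⟨B, C, hd, hle⟩ := d.lam_inversion (v := v)
    obtain ⟨c, hc⟩ := (ih hn.of_lam).1 _ _ hd
    exact ⟨c, hc.lam hle⟩

/-- For each intersection type `A` there is an `n` such that every
closed beta normal term `M` with `⊢ M : A` derivable in BCD has class `n`. -/
theorem class_bound_of_type (A : Ty) :
    ∃ n : ℕ, ∀ M : Term, Term.Closed M → Term.BetaNormal M → BCD [] M A →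
      Term.HasClass n M := by
  refine ⟨te (fun _ => 0) true A, fun M _ hn hd => ?_⟩
  obtain ⟨c, hc⟩ := (BCD.bounded_and_spineBounded (fun _ => 0) hn).1 [] A hd
  exact hc.hasClass
end

section
/- (Uniqueness Lemma) Suppose A = A_1→(...(A_k→B)...) is a functional type and there exists a term X in beta-eta normal form such that x_1:A_1, ..., x_k:A_k ⊢ X : B is derivable in BCD. Then X is unique: any two terms in beta-eta normal form of this type in this basis are identical (up to alpha conversion). -/
namespace Term

/-- The variable `k` does not occur freely. -/
def Fresh : ℕ → Term → Prop
  | k, var n => n ≠ k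
  | k, app s t => Fresh k s ∧ Fresh k t
  | k, lam t => Fresh (k + 1) t

def IsLam : Term → Prop
  | lam _ => True
  | _ => False

/-- Structural description of beta-eta normal forms. -/
def NF : Term → Prop
  | var _ => True
  | app s t => NF s ∧ NF t ∧ ¬ IsLam s
  | lam t => NF t ∧ ∀ s, t = app s (var 0) → ¬ Fresh 0 s

theorem fresh_lift_self (k : ℕ) (t : Term) : Fresh k (lift 1 k t) := by
  induction t generalizing k with
  | var n =>
    simp only [lift]
    split <;> simp only [Fresh] <;> omega
  | app s t hs ht => exact ⟨hs k, ht k⟩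
  | lam t ht => exact ht (k + 1)

theorem Fresh.exists_lift {k : ℕ} {t : Term} (h : Fresh k t) : ∃ u, t = lift 1 k u := by
  induction t generalizing k with
  | var n =>
    rcases Nat.lt_or_gt_of_ne h with h | h
    · exact ⟨var n, by simp [lift, h]⟩
    · refine ⟨var (n - 1), ?_⟩
      simp only [lift]
      rw [if_neg (by omega)]
      congr 1
      omega
  | app s t hs ht =>
    obtain ⟨u, rfl⟩ := hs h.1
    obtain ⟨v, rfl⟩ := ht h.2
    exact ⟨app u v, rfl⟩
  | lam t ht =>
    obtain ⟨u, rfl⟩ := ht (k := k + 1) h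
    exact ⟨lam u, rfl⟩

theorem Fresh.of_lift {j k : ℕ} {t : Term} (hjk : j < k) (h : Fresh j (lift 1 k t)) :
    Fresh j t := by
  induction t generalizing j k with
  | var n =>
    simp only [lift] at h
    split at h <;> simp only [Fresh] at * <;> omega
  | app s t hs ht => exact ⟨hs hjk h.1, ht hjk h.2⟩
  | lam t ht => exact ht (j := j + 1) (k := k + 1) (by omega) h

theorem lift_injective (k : ℕ) : Function.Injective (lift 1 k) := by
  intro s t h
  induction s generalizing k t with
  | var n =>
    cases t with
    | var m =>
      simp only [lift] at h
      split at h <;> split at h <;> simp only [var.injEq] at * <;> omega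
    | app => simp only [lift] at h; split at h <;> cases h
    | lam => simp only [lift] at h; split at h <;> cases h
  | app s u hs hu =>
    cases t with
    | var m => simp only [lift] at h; split at h <;> cases h
    | app =>
      simp only [lift, app.injEq] at h
      rw [hs k h.1, hu k h.2]
    | lam => simp [lift] at h
  | lam s hs =>
    cases t with
    | var m => simp only [lift] at h; split at h <;> cases h
    | app => simp [lift] at h
    | lam =>
      simp only [lift, lam.injEq] at h
      rw [hs (k + 1) h]

theorem isLam_lift {k : ℕ} {t : Term} : IsLam (lift 1 k t) ↔ IsLam t := by
  cases t with
  | var n => simp only [lift]; split <;> rfl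
  | app => rfl
  | lam => rfl

theorem NF.lift {t : Term} (h : NF t) (k : ℕ) : NF (lift 1 k t) := by
  induction t generalizing k with
  | var n => simp only [Term.lift]; split <;> trivial
  | app s t hs ht => exact ⟨hs h.1 k, ht h.2.1 k, fun hl => h.2.2 (isLam_lift.1 hl)⟩
  | lam t ht =>
    refine ⟨ht h.1 (k + 1), fun s hs hf => ?_⟩
    cases t with
    | var n => simp only [Term.lift] at hs; split at hs <;> cases hs
    | lam => cases hs
    | app u v =>
      simp only [Term.lift, app.injEq] at hs
      obtain ⟨rfl, hv⟩ := hs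
      refine h.2 u ?_ (hf.of_lift (Nat.succ_pos k))
      congr 1
      exact lift_injective (k + 1) (by simp [hv, Term.lift])

theorem BetaEtaNormal.nf {t : Term} (h : BetaEtaNormal t) : NF t := by
  induction t with
  | var n => trivial
  | app s t hs ht =>
    refine ⟨hs fun u hu => ?_, ht fun u hu => ?_, fun hl => ?_⟩
    · exact h _ (hu.imp (Beta.appL t) (Eta.appL t))
    · exact h _ (hu.imp (Beta.appR s) (Eta.appR s))
    · cases s with
      | lam s => exact h _ (Or.inl (Beta.beta s t))
      | var => exact hl
      | app => exact hl
  | lam t ht =>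
    refine ⟨ht fun u hu => h _ (hu.imp Beta.lam Eta.lam), ?_⟩
    rintro s rfl hf
    obtain ⟨u, rfl⟩ := hf.exists_lift
    exact h _ (Or.inr (Eta.eta u))

end Term

namespace Ty

/-- The components `D₁ → ... → Dₘ → b` of a type, after distributing `→` over `∧`. -/
def comps : Ty → List (List Ty × ℕ)
  | atom b => [([], b)]
  | arrow A B => (comps B).map fun c => (A :: c.1, c.2)
  | inter A B => comps A ++ comps B

theorem mem_comps_arrow {A B : Ty} {c : List Ty × ℕ} :
    c ∈ comps (arrow A B) ↔ ∃ Ds, (Ds, c.2) ∈ comps B ∧ c.1 = A :: Ds := by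
  obtain ⟨Cs, b⟩ := c
  simp only [comps, List.mem_map, Prod.mk.injEq, Prod.exists]
  constructor
  · rintro ⟨Ds, _, h, rfl, rfl⟩
    exact ⟨Ds, h, rfl⟩
  · rintro ⟨Ds, h, rfl⟩
    exact ⟨Ds, b, h, rfl, rfl⟩

theorem forall₂_sub_refl (Ds : List Ty) : List.Forall₂ Sub Ds Ds :=
  List.forall₂_same.2 fun A _ => Sub.refl A

theorem forall₂_sub_trans {Ds Es Fs : List Ty} (h : List.Forall₂ Sub Ds Es)
    (h' : List.Forall₂ Sub Es Fs) : List.Forall₂ Sub Ds Fs := by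
  induction h generalizing Fs with
  | nil => exact h'
  | cons h _ ih =>
    cases h' with
    | cons h₁ h₂ => exact .cons (h.trans h₁) (ih h₂)

/-- Every component of a supertype is above a component of the subtype. -/
theorem Sub.comps {A B : Ty} (h : Sub A B) {Ds : List Ty} {b : ℕ} (hD : (Ds, b) ∈ comps B) :
    ∃ Es, (Es, b) ∈ Ty.comps A ∧ List.Forall₂ Sub Ds Es := by
  induction h generalizing Ds with
  | refl A => exact ⟨Ds, hD, forall₂_sub_refl Ds⟩
  | trans _ _ ih₁ ih₂ =>
    obtain ⟨Es, hE, hDE⟩ := ih₂ hD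
    obtain ⟨Fs, hF, hEF⟩ := ih₁ hE
    exact ⟨Fs, hF, forall₂_sub_trans hDE hEF⟩
  | interL A B => exact ⟨Ds, List.mem_append_left _ hD, forall₂_sub_refl Ds⟩
  | interR A B => exact ⟨Ds, List.mem_append_right _ hD, forall₂_sub_refl Ds⟩
  | interGlb _ _ ih₁ ih₂ => exact (List.mem_append.1 hD).elim ih₁ ih₂
  | arrow h₁ _ _ ih =>
    obtain ⟨Ds, hD, rfl⟩ := mem_comps_arrow.1 hD
    obtain ⟨Es, hE, hDE⟩ := ih hD
    exact ⟨_, mem_comps_arrow.2 ⟨Es, hE, rfl⟩, .cons h₁ hDE⟩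
  | dist A B C =>
    refine ⟨Ds, ?_, forall₂_sub_refl Ds⟩
    simpa [Ty.comps] using hD

theorem sub_arrows {A : Ty} {Ds : List Ty} {b : ℕ} (h : (Ds, b) ∈ comps A) :
    Sub A (arrows Ds (atom b)) := by
  induction A generalizing Ds with
  | atom a =>
    simp only [comps, List.mem_singleton, Prod.mk.injEq] at h
    obtain ⟨rfl, rfl⟩ := h
    exact Sub.refl _
  | arrow A B _ ih =>
    obtain ⟨Ds, hD, rfl⟩ := mem_comps_arrow.1 h
    exact Sub.arrow (Sub.refl A) (ih hD)
  | inter A B ihA ihB =>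
    rcases List.mem_append.1 h with h | h
    · exact (Sub.interL A B).trans (ihA h)
    · exact (Sub.interR A B).trans (ihB h)

theorem sub_arrows_arrows {Ds Es : List Ty} {b : ℕ} (h : List.Forall₂ Sub Ds Es) :
    Sub (arrows Es (atom b)) (arrows Ds (atom b)) := by
  induction h with
  | nil => exact Sub.refl _
  | cons h _ ih => exact Sub.arrow h ih

theorem mem_comps_arrows (Ds : List Ty) (b : ℕ) : (Ds, b) ∈ comps (arrows Ds (atom b)) := by
  induction Ds with
  | nil => simp [arrows, comps]
  | cons D Ds ih => exact mem_comps_arrow.2 ⟨Ds, ih, rfl⟩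

theorem exists_eq_arrows {A : Ty} (h : interOcc true A = 0) :
    ∃ Ds b, A = arrows Ds (atom b) := by
  induction A with
  | atom b => exact ⟨[], b, rfl⟩
  | arrow A B _ ih =>
    simp only [interOcc, Nat.add_eq_zero_iff] at h
    obtain ⟨Ds, b, rfl⟩ := ih h.2
    exact ⟨A :: Ds, b, rfl⟩
  | inter A B => simp [interOcc] at h

def size : Ty → ℕ
  | atom _ => 1
  | arrow A B => size A + size B + 1
  | inter A B => size A + size B

end Ty

namespace BCD

open Ty

theorem narrow {Γ Γ' : List Ty} {t : Term} {A : Ty} (d : Deriv Γ t A)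
    (h : ∀ (n : ℕ) (B : Ty), Γ[n]? = some B → ∃ B', Γ'[n]? = some B' ∧ Sub B' B) : BCD Γ' t A := by
  induction d generalizing Γ' with
  | var Γ n A hn =>
    obtain ⟨B', hB, hs⟩ := h n A hn
    exact ⟨.sub _ _ _ _ (.var _ _ _ hB) hs⟩
  | lam Γ t A B _ ih =>
    obtain ⟨d⟩ := ih (Γ' := A :: Γ') fun n C hC => by
      cases n with
      | zero => exact ⟨C, hC, Sub.refl C⟩
      | succ n => exact h n C hC
    exact ⟨.lam _ _ _ _ d⟩
  | app Γ s t A B _ _ ih₁ ih₂ =>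
    obtain ⟨d⟩ := ih₁ h
    obtain ⟨e⟩ := ih₂ h
    exact ⟨.app _ _ _ _ _ d e⟩
  | inter Γ t A B _ _ ih₁ ih₂ =>
    obtain ⟨d⟩ := ih₁ h
    obtain ⟨e⟩ := ih₂ h
    exact ⟨.inter _ _ _ _ d e⟩
  | sub Γ t A B _ hs ih =>
    obtain ⟨d⟩ := ih h
    exact ⟨.sub _ _ _ _ d hs⟩

theorem weaken {Γ Γ' : List Ty} {t : Term} {A : Ty} (d : Deriv Γ t A) {k : ℕ}
    (h : ∀ (n : ℕ) (B : Ty), Γ[n]? = some B → Γ'[if n < k then n else n + 1]? = some B) :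
    BCD Γ' (Term.lift 1 k t) A := by
  induction d generalizing Γ' k with
  | var Γ n A hn =>
    have := h n A hn
    simp only [Term.lift]
    split <;> rename_i hk <;> simp only [hk, if_true, if_false] at this
    · exact ⟨.var _ _ _ this⟩
    · exact ⟨.var _ _ _ this⟩
  | lam Γ t A B _ ih =>
    obtain ⟨d⟩ := ih (Γ' := A :: Γ') (k := k + 1) fun n C hC => by
      cases n with
      | zero => simpa using hC
      | succ n =>
        have := h n C (by simpa using hC)
        by_cases hk : n < k <;> simpa [hk] using this
    exact ⟨.lam _ _ _ _ d⟩
  | app Γ s t A B _ _ ih₁ ih₂ =>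
    obtain ⟨d⟩ := ih₁ h
    obtain ⟨e⟩ := ih₂ h
    exact ⟨.app _ _ _ _ _ d e⟩
  | inter Γ t A B _ _ ih₁ ih₂ =>
    obtain ⟨d⟩ := ih₁ h
    obtain ⟨e⟩ := ih₂ h
    exact ⟨.inter _ _ _ _ d e⟩
  | sub Γ t A B _ hs ih =>
    obtain ⟨d⟩ := ih h
    exact ⟨.sub _ _ _ _ d hs⟩

theorem app_lift_var {Γ : List Ty} {t : Term} {A B : Ty} (h : BCD Γ t (arrow A B)) :
    BCD (A :: Γ) (Term.app (Term.lift 1 0 t) (Term.var 0)) B := by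
  obtain ⟨d⟩ := h
  obtain ⟨e⟩ := weaken d (Γ' := A :: Γ) (k := 0) fun n C hC => by simpa using hC
  exact ⟨.app _ _ _ _ _ e (.var _ _ _ rfl)⟩

theorem lam_comps {Γ : List Ty} {t : Term} {A : Ty} (h : BCD Γ (Term.lam t) A) {Ds : List Ty}
    {b : ℕ} (hD : (Ds, b) ∈ comps A) :
    ∃ C Es, Ds = C :: Es ∧ BCD (C :: Γ) t (arrows Es (atom b)) := by
  obtain ⟨d⟩ := h
  generalize hu : Term.lam t = u at d
  induction d generalizing Ds t with
  | var => cases hu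
  | app => cases hu
  | lam Γ t' A B d _ =>
    cases hu
    obtain ⟨Es, hE, rfl⟩ := mem_comps_arrow.1 hD
    exact ⟨A, Es, rfl, ⟨.sub _ _ _ _ d (sub_arrows hE)⟩⟩
  | inter Γ t' A B _ _ ih₁ ih₂ =>
    exact (List.mem_append.1 hD).elim (fun h => ih₁ h hu) (fun h => ih₂ h hu)
  | sub Γ t' A B _ hs ih =>
    obtain ⟨Es, hE, hDE⟩ := hs.comps hD
    obtain ⟨C, Fs, rfl, ⟨d⟩⟩ := ih hE hu
    cases hDE with
    | @cons D _ Ds _ hDC hDF =>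
      refine ⟨D, Ds, rfl, narrow (.sub _ _ _ _ d (sub_arrows_arrows hDF)) fun n B hB => ?_⟩
      cases n with
      | zero =>
        cases hB
        exact ⟨D, rfl, hDC⟩
      | succ n => exact ⟨B, hB, Sub.refl B⟩

theorem lam_inv {Γ : List Ty} {t : Term} {A B : Ty} (h : BCD Γ (Term.lam t) (arrow A B))
    (hB : interOcc true B = 0) : BCD (A :: Γ) t B := by
  obtain ⟨Ds, b, rfl⟩ := exists_eq_arrows hB
  obtain ⟨C, Es, h₁, h₂⟩ := lam_comps h (mem_comps_arrow.2 ⟨Ds, mem_comps_arrows Ds b, rfl⟩)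
  cases h₁
  exact h₂

theorem neutral_comps {Γ : List Ty} {t : Term} {A : Ty} (h : BCD Γ t A) (hn : t.NF)
    (hl : ¬ t.IsLam) {Ds : List Ty} {b : ℕ} (hD : (Ds, b) ∈ comps A) :
    ∃ n G args Es Fs, t = List.foldl Term.app (Term.var n) args ∧ Γ[n]? = some G ∧
      (Es ++ Fs, b) ∈ comps G ∧ List.Forall₂ (fun u E => BCD Γ u E ∧ u.NF) args Es ∧
      List.Forall₂ Sub Ds Fs := by
  obtain ⟨d⟩ := h
  induction d generalizing Ds with
  | var Γ n A hA => exact ⟨n, A, [], [], Ds, rfl, hA, hD, .nil, forall₂_sub_refl Ds⟩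
  | lam => exact absurd trivial hl
  | app Γ s t A B _ e ih _ =>
    obtain ⟨n, G, args, Es, _, rfl, hG, hE, ha, hF⟩ :=
      ih hn.1 hn.2.2 (mem_comps_arrow.2 ⟨Ds, hD, rfl⟩)
    cases hF with
    | @cons _ F _ Fs hAF hF =>
      refine ⟨n, G, args ++ [t], Es ++ [F], Fs, by simp, hG, by simpa using hE, ?_, hF⟩
      exact List.rel_append ha (.cons ⟨⟨.sub _ _ _ _ e hAF⟩, hn.2.1⟩ .nil)
  | inter Γ t A B _ _ ih₁ ih₂ =>
    exact (List.mem_append.1 hD).elim (ih₁ hn hl) (ih₂ hn hl)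
  | sub Γ t A B _ hs ih =>
    obtain ⟨Es', hE', hDE⟩ := hs.comps hD
    obtain ⟨n, G, args, Es, Fs, h₁, hG, hE, ha, hF⟩ := ih hn hl hE'
    exact ⟨n, G, args, Es, Fs, h₁, hG, hE, ha, forall₂_sub_trans hDE hF⟩

theorem not_isLam_of_atom {Γ : List Ty} {t : Term} {b : ℕ} (h : BCD Γ t (atom b)) :
    ¬ t.IsLam := by
  intro hl
  cases t with
  | var => exact hl
  | app => exact hl
  | lam t =>
    obtain ⟨C, Es, hE, _⟩ := lam_comps h (Ds := []) (b := b) (by simp [comps])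
    cases hE

theorem atom_inv {Γ : List Ty} {t : Term} {b : ℕ} (h : BCD Γ t (atom b)) (hn : t.NF) :
    ∃ n G args Es, t = List.foldl Term.app (Term.var n) args ∧ Γ[n]? = some G ∧
      (Es, b) ∈ comps G ∧ List.Forall₂ (fun u E => BCD Γ u E ∧ u.NF) args Es := by
  obtain ⟨n, G, args, Es, Fs, h₁, hG, hE, ha, hF⟩ :=
    neutral_comps h hn (not_isLam_of_atom h) (Ds := []) (b := b) (by simp [comps])
  cases hF
  exact ⟨n, G, args, Es, h₁, hG, by simpa using hE, ha⟩

end BCD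

namespace Ty

/-- Occurrences of an atom in the component `D₁ → ... → Dₘ → b`. -/
def occComp (a : ℕ) (s : Bool) (c : List Ty × ℕ) : ℕ :=
  occ a s (atom c.2) + (c.1.map (occ a (!s))).sum

def sizeComp (c : List Ty × ℕ) : ℕ := 1 + (c.1.map size).sum

theorem Dnf.comps_eq_singleton {A : Ty} (h : Dnf A) (hi : ¬ IsInter A) :
    ∃ c, comps A = [c] := by
  induction A with
  | atom b => exact ⟨_, rfl⟩
  | arrow A B _ ih =>
    obtain ⟨c, hc⟩ := ih h.2.1 h.2.2
    exact ⟨_, by rw [comps, hc]; rfl⟩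
  | inter A B => exact absurd trivial hi

theorem Dnf.sum_occComp {A : Ty} (h : Dnf A) (a : ℕ) (s : Bool) :
    ((comps A).map (occComp a s)).sum = occ a s A := by
  induction A with
  | atom b => simp [comps, occComp]
  | arrow A B _ ih =>
    obtain ⟨c, hc⟩ := h.2.1.comps_eq_singleton h.2.2
    have := ih h.2.1
    simp only [comps, hc, occComp, occ, List.map_cons, List.map_nil, List.sum_cons,
      List.sum_nil] at this ⊢
    omega
  | inter A B ihA ihB => simp [comps, occ, ihA h.1, ihB h.2]

theorem Dnf.sum_sizeComp_le {A : Ty} (h : Dnf A) :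
    ((comps A).map sizeComp).sum ≤ size A := by
  induction A with
  | atom b => simp [comps, sizeComp, size]
  | arrow A B _ ih =>
    obtain ⟨c, hc⟩ := h.2.1.comps_eq_singleton h.2.2
    have := ih h.2.1
    simp only [comps, hc, sizeComp, size, List.map_cons, List.map_nil, List.sum_cons,
      List.sum_nil] at this ⊢
    omega
  | inter A B ihA ihB =>
    have := ihA h.1
    have := ihB h.2
    simp only [comps, size, List.map_append, List.sum_append]
    omega

theorem Dnf.of_mem_comps {A : Ty} (h : Dnf A) (hi : interOcc false A = 0) {c : List Ty × ℕ}
    (hc : c ∈ comps A) {D : Ty} (hD : D ∈ c.1) : Dnf D ∧ interOcc true D = 0 := by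
  induction A generalizing c with
  | atom b =>
    simp only [comps, List.mem_singleton] at hc
    subst hc
    cases hD
  | arrow A B _ ih =>
    simp only [interOcc, Bool.not_false, Nat.add_eq_zero_iff] at hi
    obtain ⟨Es, hE, hc⟩ := mem_comps_arrow.1 hc
    rw [hc] at hD
    rcases List.mem_cons.1 hD with rfl | hD
    · exact ⟨h.1, hi.1⟩
    · exact ih h.2.1 hi.2 hE hD
  | inter A B ihA ihB =>
    simp only [interOcc, Nat.add_eq_zero_iff] at hi
    rcases List.mem_append.1 hc with hc | hc
    · exact ihA h.1 hi.1.2 hc hD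
    · exact ihB h.2 hi.2 hc hD

/-- Extend a list of hypotheses (variables together with a component of their type) by a
new variable `0` of type `C`. -/
def bind (C : Ty) (L : List (ℕ × List Ty × ℕ)) : List (ℕ × List Ty × ℕ) :=
  (comps C).map (fun c => (0, c)) ++ L.map fun e => (e.1 + 1, e.2)

theorem sum_map_bind (f : List Ty × ℕ → ℕ) (C : Ty) (L : List (ℕ × List Ty × ℕ)) :
    ((bind C L).map fun e => f e.2).sum =
      ((comps C).map f).sum + (L.map fun e => f e.2).sum := by
  simp [bind, Function.comp_def]

theorem mem_bind_zero {C : Ty} {L : List (ℕ × List Ty × ℕ)} {c : List Ty × ℕ}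
    (h : c ∈ comps C) : (0, c) ∈ bind C L :=
  List.mem_append_left _ (List.mem_map.2 ⟨c, h, rfl⟩)

theorem mem_bind_succ {C : Ty} {L : List (ℕ × List Ty × ℕ)} {n : ℕ} {c : List Ty × ℕ}
    (h : (n, c) ∈ L) : (n + 1, c) ∈ bind C L :=
  List.mem_append_right _ (List.mem_map.2 ⟨(n, c), h, rfl⟩)

theorem of_mem_bind {C : Ty} {L : List (ℕ × List Ty × ℕ)} {e : ℕ × List Ty × ℕ}
    (h : e ∈ bind C L) : e.2 ∈ comps C ∨ ∃ n, (n, e.2) ∈ L := by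
  rcases List.mem_append.1 h with h | h
  · obtain ⟨c, hc, rfl⟩ := List.mem_map.1 h
    exact Or.inl hc
  · obtain ⟨e, he, rfl⟩ := List.mem_map.1 h
    exact Or.inr ⟨e.1, he⟩

/-- Occurrences of an atom in the sequent with hypotheses `L` and goal `D`. -/
def occSeq (a : ℕ) (s : Bool) (L : List (ℕ × List Ty × ℕ)) (D : Ty) : ℕ :=
  occ a s D + (L.map fun e => occComp a (!s) e.2).sum

theorem occSeq_bind {C : Ty} (h : Dnf C) (a : ℕ) (s : Bool) (L : List (ℕ × List Ty × ℕ))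
    (D : Ty) : occSeq a s (bind C L) D = occSeq a s L (arrow C D) := by
  rw [occSeq, occSeq, sum_map_bind, h.sum_occComp, occ]
  omega

def sizeSeq (L : List (ℕ × List Ty × ℕ)) (D : Ty) : ℕ :=
  size D + (L.map fun e => sizeComp e.2).sum

theorem sizeSeq_bind_lt {C : Ty} (h : Dnf C) (L : List (ℕ × List Ty × ℕ)) (D : Ty) :
    sizeSeq (bind C L) D < sizeSeq L (arrow C D) := by
  have := h.sum_sizeComp_le
  rw [sizeSeq, sizeSeq, sum_map_bind, size]
  omega

/-- The invariant of proof search from the basis `Γ` towards the goal `D`: `L` lists the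
usable hypotheses, the others end in an atom of `S`, and no goal ending in an atom of `S`
can be met any more. -/
structure Linear (Γ : List Ty) (L : List (ℕ × List Ty × ℕ)) (S : Set ℕ) (D : Ty) : Prop where
  dnf : Dnf D
  inter : interOcc true D = 0
  args : ∀ e ∈ L, ∀ E ∈ e.2.1, Dnf E ∧ interOcc true E = 0
  cover : ∀ n G c, Γ[n]? = some G → c ∈ comps G → c.2 ∈ S ∨ (n, c) ∈ L
  occ_le : ∀ a s, occSeq a s L D ≤ 1
  dead : ∀ a ∈ S, occSeq a true L D = 0

theorem Linear.intro {Γ : List Ty} {L : List (ℕ × List Ty × ℕ)} {S : Set ℕ} {C D : Ty}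
    (h : Linear Γ L S (arrow C D)) : Linear (C :: Γ) (bind C L) S D where
  dnf := h.dnf.2.1
  inter := by
    have := h.inter
    simp only [interOcc] at this
    omega
  args e he E hE := by
    rcases of_mem_bind he with he | ⟨n, he⟩
    · have := h.inter
      simp only [interOcc, Bool.not_true] at this
      exact h.dnf.1.of_mem_comps (by omega) he hE
    · exact h.args _ he E hE
  cover n G c hG hc := by
    cases n with
    | zero =>
      cases hG
      exact Or.inr (mem_bind_zero hc)
    | succ n => exact (h.cover n G c hG hc).imp_right mem_bind_succ
  occ_le a s := by rw [occSeq_bind h.dnf.1]; exact h.occ_le a s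
  dead a ha := by rw [occSeq_bind h.dnf.1]; exact h.dead a ha

theorem sum_map_eq_add_erase {α : Type*} [BEq α] [LawfulBEq α] (f : α → ℕ) {a : α} {l : List α}
    (h : a ∈ l) : (l.map f).sum = f a + ((l.erase a).map f).sum := by
  simpa using ((List.perm_cons_erase h).map f).sum_eq

theorem occSeq_erase_le {L : List (ℕ × List Ty × ℕ)} {e : ℕ × List Ty × ℕ} (he : e ∈ L)
    {E : Ty} (hE : E ∈ e.2.1) (a : ℕ) (s : Bool) :
    occSeq a s (L.erase e) E ≤ (L.map fun e => occComp a (!s) e.2).sum := by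
  have h₁ := sum_map_eq_add_erase (fun e : ℕ × List Ty × ℕ => occComp a (!s) e.2) he
  have h₂ := List.single_le_sum (l := e.2.1.map (occ a s)) (by simp) _ (List.mem_map_of_mem hE)
  have h₃ : occComp a (!s) e.2 = occ a (!s) (atom e.2.2) + (e.2.1.map (occ a s)).sum := by
    simp [occComp]
  rw [occSeq]
  omega

theorem sizeSeq_erase_lt {L : List (ℕ × List Ty × ℕ)} {e : ℕ × List Ty × ℕ} (he : e ∈ L)
    {E : Ty} (hE : E ∈ e.2.1) (b : ℕ) : sizeSeq (L.erase e) E < sizeSeq L (atom b) := by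
  have h₁ := sum_map_eq_add_erase (fun e : ℕ × List Ty × ℕ => sizeComp e.2) he
  have h₂ := List.single_le_sum (l := e.2.1.map size) (by simp) _ (List.mem_map_of_mem hE)
  rw [sizeSeq, sizeSeq, size]
  simp only [sizeComp] at h₁ ⊢
  omega

theorem Linear.arg {Γ : List Ty} {L : List (ℕ × List Ty × ℕ)} {S : Set ℕ} {b : ℕ}
    (h : Linear Γ L S (atom b)) {e : ℕ × List Ty × ℕ} (he : e ∈ L) (heb : e.2.2 = b)
    (huniq : ∀ e' ∈ L, e'.2.2 = b → e' = e) {E : Ty} (hE : E ∈ e.2.1) :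
    Linear Γ (L.erase e) (insert b S) E where
  dnf := (h.args e he E hE).1
  inter := (h.args e he E hE).2
  args e' he' := h.args e' (List.mem_of_mem_erase he')
  cover n G c hG hc := by
    by_cases hcb : c.2 = b
    · exact Or.inl (Or.inl hcb)
    · refine (h.cover n G c hG hc).imp Or.inr fun hm => ?_
      refine (List.mem_erase_of_ne ?_).2 hm
      rintro rfl
      exact hcb heb
  occ_le a s := by
    have h₁ := h.occ_le a s
    have h₂ := occSeq_erase_le he hE a s
    rw [occSeq] at h₁
    omega
  dead a ha := by
    have h₂ := occSeq_erase_le he hE a true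
    rcases ha with rfl | ha
    · have h₁ := h.occ_le a true
      simp only [occSeq, occ, if_true] at h₁
      simp only [Bool.not_true] at h₁ h₂
      omega
    · have h₁ := h.dead a ha
      rw [occSeq] at h₁
      omega

theorem Linear.mem {Γ : List Ty} {L : List (ℕ × List Ty × ℕ)} {S : Set ℕ} {b : ℕ}
    (h : Linear Γ L S (atom b)) {n : ℕ} {G : Ty} {Es : List Ty} (hG : Γ[n]? = some G)
    (hE : (Es, b) ∈ comps G) : (n, Es, b) ∈ L := by
  refine (h.cover n G _ hG hE).resolve_left fun hb => ?_
  have := h.dead b hb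
  simp [occSeq, occ] at this

theorem Linear.eq_of_mem {Γ : List Ty} {L : List (ℕ × List Ty × ℕ)} {S : Set ℕ} {D : Ty}
    (h : Linear Γ L S D) {e e' : ℕ × List Ty × ℕ} (he : e ∈ L) (he' : e' ∈ L)
    (hb : e'.2.2 = e.2.2) : e' = e := by
  by_contra hne
  have h₁ := sum_map_eq_add_erase (fun x : ℕ × List Ty × ℕ => occComp e.2.2 true x.2) he
  have h₂ := List.single_le_sum
    (l := (L.erase e).map fun x : ℕ × List Ty × ℕ => occComp e.2.2 true x.2) (by simp) _
    (List.mem_map_of_mem ((List.mem_erase_of_ne hne).2 he'))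
  have h₃ := h.occ_le e.2.2 false
  simp only [occSeq, Bool.not_false] at h₃
  have h₄ : 1 ≤ occComp e.2.2 true e.2 := by simp [occComp, occ]
  have h₅ : 1 ≤ occComp e.2.2 true e'.2 := by simp [occComp, occ, hb]
  omega

theorem forall₂_unique {α β : Type*} {R : α → β → Prop} {l l' : List α} {m : List β}
    (h : List.Forall₂ R l m) (h' : List.Forall₂ R l' m)
    (hR : ∀ b ∈ m, ∀ x y, R x b → R y b → x = y) : l = l' := by
  induction h generalizing l' with
  | nil => cases h'; rfl
  | cons h _ ih =>
    cases h' with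
    | cons h₁ h₂ =>
      rw [hR _ (by simp) _ _ h h₁, ih h₂ fun b hb => hR b (by simp [hb])]

theorem Linear.unique {Γ : List Ty} {L : List (ℕ × List Ty × ℕ)} {S : Set ℕ} {D : Ty}
    (h : Linear Γ L S D) {t u : Term} (ht : t.NF) (hu : u.NF) (dt : BCD Γ t D)
    (du : BCD Γ u D) : t = u := by
  induction hm : sizeSeq L D using Nat.strong_induction_on generalizing Γ L S D t u with
  | _ m ih =>
    subst hm
    cases D with
    | inter A B => have := h.inter; simp [interOcc] at this
    | atom b =>
      obtain ⟨n, G, args, Es, rfl, hG, hE, ha⟩ := dt.atom_inv ht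
      obtain ⟨n', G', args', Es', rfl, hG', hE', ha'⟩ := du.atom_inv hu
      have he := h.mem hG hE
      have heq := h.eq_of_mem he (h.mem hG' hE') rfl
      simp only [Prod.mk.injEq, and_true] at heq
      obtain ⟨rfl, rfl⟩ := heq
      congr 1
      refine forall₂_unique ha ha' fun E hEs x y hx hy => ?_
      exact ih _ (sizeSeq_erase_lt he hEs b)
        (h.arg he rfl (fun e' h' hb => h.eq_of_mem he h' hb) hEs) hx.2 hy.2 hx.1 hy.1 rfl
    | arrow C D =>
      have key : ∀ {x y : Term}, x.NF → y.NF → BCD (C :: Γ) x D → BCD (C :: Γ) y D → x = y :=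
        fun hx hy dx dy => ih _ (sizeSeq_bind_lt h.dnf.1 L D) h.intro hx hy dx dy rfl
      have expand : ∀ {x : Term}, x.NF → ¬ x.IsLam →
          (Term.app (Term.lift 1 0 x) (Term.var 0)).NF := fun hx hl =>
        ⟨hx.lift 0, trivial, fun h => hl (Term.isLam_lift.1 h)⟩
      have mixed : ∀ {x y : Term}, (Term.lam x).NF → y.NF → ¬ y.IsLam →
          BCD Γ (Term.lam x) (arrow C D) → BCD Γ y (arrow C D) → False :=
        fun hx hy hl dx dy => hx.2 _
          (key hx.1 (expand hy hl) (dx.lam_inv h.intro.inter) dy.app_lift_var)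
          (Term.fresh_lift_self 0 _)
      by_cases hlt : t.IsLam
      · obtain ⟨t, rfl⟩ : ∃ t', t = Term.lam t' := by cases t <;> simp_all [Term.IsLam]
        by_cases hlu : u.IsLam
        · obtain ⟨u, rfl⟩ : ∃ u', u = Term.lam u' := by cases u <;> simp_all [Term.IsLam]
          rw [key ht.1 hu.1 (dt.lam_inv h.intro.inter) (du.lam_inv h.intro.inter)]
        · exact (mixed ht hu hlu dt du).elim
      · by_cases hlu : u.IsLam
        · obtain ⟨u, rfl⟩ : ∃ u', u = Term.lam u' := by cases u <;> simp_all [Term.IsLam]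
          exact (mixed hu ht hlt du dt).elim
        · have := key (expand ht hlt) (expand hu hlu) dt.app_lift_var du.app_lift_var
          exact Term.lift_injective 0 (Term.app.inj this).1

/-- All components of the types of a basis. -/
def hyps : List Ty → List (ℕ × List Ty × ℕ)
  | [] => []
  | A :: Γ => bind A (hyps Γ)

theorem dnf_arrows {Γ : List Ty} {B : Ty} (h : Dnf (arrows Γ B)) :
    Dnf B ∧ ∀ A ∈ Γ, Dnf A := by
  induction Γ with
  | nil => exact ⟨h, by simp⟩
  | cons A Γ ih =>
    obtain ⟨h₁, h₂⟩ := ih h.2.1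
    exact ⟨h₁, List.forall_mem_cons.2 ⟨h.1, h₂⟩⟩

theorem interOcc_arrows {Γ : List Ty} {B : Ty} (h : interOcc true (arrows Γ B) = 0) :
    interOcc true B = 0 ∧ ∀ A ∈ Γ, interOcc false A = 0 := by
  induction Γ with
  | nil => exact ⟨h, by simp⟩
  | cons A Γ ih =>
    have h' : interOcc false A + interOcc true (arrows Γ B) = 0 := h
    obtain ⟨h₁, h₂⟩ := ih (by omega)
    exact ⟨h₁, List.forall_mem_cons.2 ⟨by omega, h₂⟩⟩

theorem occSeq_hyps {Γ : List Ty} {B : Ty} (h : ∀ A ∈ Γ, Dnf A) (a : ℕ) (s : Bool) :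
    occSeq a s (hyps Γ) B = occ a s (arrows Γ B) := by
  induction Γ with
  | nil => simp [hyps, occSeq, arrows]
  | cons A Γ ih =>
    obtain ⟨hA, h⟩ := List.forall_mem_cons.1 h
    have := ih h
    rw [hyps, occSeq_bind hA]
    change _ = occ a (!s) A + occ a s (arrows Γ B)
    rw [← this, occSeq, occSeq, occ]
    omega

theorem mem_hyps {Γ : List Ty} {n : ℕ} {G : Ty} {c : List Ty × ℕ} (hG : Γ[n]? = some G)
    (hc : c ∈ comps G) : (n, c) ∈ hyps Γ := by
  induction Γ generalizing n with
  | nil => simp at hG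
  | cons A Γ ih =>
    cases n with
    | zero =>
      cases hG
      exact mem_bind_zero hc
    | succ n => exact mem_bind_succ (ih hG)

theorem exists_of_mem_hyps {Γ : List Ty} {e : ℕ × List Ty × ℕ} (h : e ∈ hyps Γ) :
    ∃ A ∈ Γ, e.2 ∈ comps A := by
  induction Γ generalizing e with
  | nil => cases h
  | cons A Γ ih =>
    rcases of_mem_bind h with h | ⟨n, h⟩
    · exact ⟨A, by simp, h⟩
    · obtain ⟨B, hB, hc⟩ := ih h
      exact ⟨B, by simp [hB], hc⟩

theorem Functional.linear {Γ : List Ty} {B : Ty} (h : Functional (arrows Γ B)) :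
    Linear Γ (hyps Γ) ∅ B where
  dnf := (dnf_arrows h.1).1
  inter := (interOcc_arrows h.2.2).1
  args e he E hE := by
    obtain ⟨A, hA, hc⟩ := exists_of_mem_hyps he
    exact ((dnf_arrows h.1).2 A hA).of_mem_comps ((interOcc_arrows h.2.2).2 A hA) hc hE
  cover n G c hG hc := Or.inr (mem_hyps hG hc)
  occ_le a s := by
    rw [occSeq_hyps (dnf_arrows h.1).2]
    cases s
    · exact (h.2.1 a).2
    · exact (h.2.1 a).1
  dead a ha := ha.elim

end Ty

/-- Uniqueness Lemma: Suppose `A = A₁ → ( ... (A_k → B) ...)` is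
functional.  Then any two beta-eta normal terms `X₁`, `X₂` with
`x₁:A₁, ..., x_k:A_k ⊢ Xⱼ : B` derivable in BCD are identical (with de Bruijn
representation, identity up to alpha conversion is literal identity). -/
theorem uniqueness_lemma (k : ℕ) (A : ℕ → Ty) (B : Ty) (X₁ X₂ : Term)
    (hfun : Ty.Functional (Ty.arrows ((List.range k).map fun j => A (j + 1)) B))
    (h₁ : Term.BetaEtaNormal X₁) (h₂ : Term.BetaEtaNormal X₂)
    (t₁ : BCD ((List.range k).map fun j => A (j + 1)) X₁ B)
    (t₂ : BCD ((List.range k).map fun j => A (j + 1)) X₂ B) :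
    X₁ = X₂ := by
  exact hfun.linear.unique h₁.nf h₂.nf t₁ t₂
end

section
/- (Class n Theorem) For each natural number n there exists an intersection type A such that for every closed lambda term M in beta-eta normal form of class n, ⊢ M : A is derivable in BCD. -/
namespace Term

theorem sizeOf_stripPrefix_le (t : Term) : sizeOf (stripPrefix t) ≤ sizeOf t := by
  induction t with
  | var n => simp [stripPrefix]
  | app s t _ _ => simp [stripPrefix]
  | lam t ih => simp only [stripPrefix, Term.lam.sizeOf_spec]; omega

theorem sizeOf_lt_of_mem_spineArgs {t u : Term} (h : u ∈ spineArgs t) :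
    sizeOf u < sizeOf t := by
  induction t with
  | var n => simp [spineArgs] at h
  | app s t ihs _ =>
    simp only [spineArgs, List.mem_append, List.mem_singleton] at h
    simp only [Term.app.sizeOf_spec]
    rcases h with h | rfl
    · have := ihs h; omega
    · omega
  | lam t _ => simp [spineArgs] at h

theorem sizeOf_lt_of_mem_argsOf {t u : Term} (h : u ∈ argsOf t) : sizeOf u < sizeOf t :=
  (sizeOf_lt_of_mem_spineArgs h).trans_le (sizeOf_stripPrefix_le t)

theorem BetaNormal.stripPrefix {t : Term} (h : BetaNormal t) : BetaNormal (stripPrefix t) := by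
  induction t with
  | var n => exact h
  | app s t _ _ => exact h
  | lam t ih => exact ih fun u hu => h _ (.lam hu)

theorem BetaNormal.of_mem_spineArgs {t u : Term} (h : BetaNormal t) (hu : u ∈ spineArgs t) :
    BetaNormal u := by
  induction t with
  | var n => simp [spineArgs] at hu
  | app s t ihs _ =>
    simp only [spineArgs, List.mem_append, List.mem_singleton] at hu
    rcases hu with hu | rfl
    · exact ihs (fun v hv => h _ (.appL _ hv)) hu
    · exact fun v hv => h _ (.appR _ hv)
  | lam t _ => simp [spineArgs] at hu

theorem BetaNormal.of_mem_argsOf {t u : Term} (h : BetaNormal t) (hu : u ∈ argsOf t) :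
    BetaNormal u :=
  h.stripPrefix.of_mem_spineArgs hu

theorem BetaNormal.exists_spineHead {t : Term} (h : BetaNormal t) (ht : ∀ s, t ≠ lam s) :
    ∃ n, spineHead t = some n := by
  induction t with
  | var n => exact ⟨n, rfl⟩
  | app s t ihs _ =>
    refine ihs (fun v hv => h _ (.appL _ hv)) ?_
    rintro s rfl
    exact h _ (.beta _ _)
  | lam t _ => exact absurd rfl (ht t)

theorem stripPrefix_ne_lam (t s : Term) : Term.stripPrefix t ≠ lam s := by
  induction t with
  | var n => simp [Term.stripPrefix]
  | app s t _ _ => simp [Term.stripPrefix]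
  | lam t ih => exact ih

theorem BetaNormal.exists_headOf {t : Term} (h : BetaNormal t) : ∃ n, headOf t = some n :=
  h.stripPrefix.exists_spineHead (stripPrefix_ne_lam t)

theorem ClosedUnder.stripPrefix {t : Term} {k : ℕ} (h : ClosedUnder k t) :
    ClosedUnder (k + prefixLen t) (stripPrefix t) := by
  induction t generalizing k with
  | var n => exact h
  | app s t _ _ => exact h
  | lam t ih =>
    have := ih (k := k + 1) h
    rwa [Nat.add_assoc, Nat.add_comm 1] at this

theorem ClosedUnder.of_mem_spineArgs {t u : Term} {k : ℕ} (h : ClosedUnder k t)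
    (hu : u ∈ spineArgs t) : ClosedUnder k u := by
  induction t with
  | var n => simp [spineArgs] at hu
  | app s t ihs _ =>
    simp only [spineArgs, List.mem_append, List.mem_singleton] at hu
    rcases hu with hu | rfl
    · exact ihs h.1 hu
    · exact h.2
  | lam t _ => simp [spineArgs] at hu

theorem ClosedUnder.lt_of_spineHead {t : Term} {k n : ℕ} (h : ClosedUnder k t)
    (hn : spineHead t = some n) : n < k := by
  induction t with
  | var m =>
    simp only [spineHead, Option.some.injEq] at hn
    exact hn ▸ h
  | app s t ihs _ => exact ihs h.1 hn
  | lam t _ => simp [spineHead] at hn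

theorem ClosedUnder.desc {t w : Term} {d k : ℕ} (h : ClosedUnder k t) (hw : Desc t d w) :
    ClosedUnder (k + d) w := by
  induction hw generalizing k with
  | refl t => exact h
  | step hu _ ih =>
    have := ih (h.stripPrefix.of_mem_spineArgs hu)
    rwa [Nat.add_assoc] at this

end Term

namespace Ty

/-- Intersection of a list of types (and of an atom, there being no top type). -/
def bigInter (l : List Ty) : Ty := l.foldr inter (atom 0)

theorem bigInter_sub {l : List Ty} {A : Ty} (h : A ∈ l) : Sub (bigInter l) A := by
  induction l with
  | nil => simp at h
  | cons B l ih =>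
    rcases List.mem_cons.1 h with rfl | h
    · exact .interL _ _
    · exact .trans (.interR _ _) (ih h)

/-- The lists of length at most `n` with entries in `D`. -/
def listsUpTo (D : List Ty) : ℕ → List (List Ty)
  | 0 => [[]]
  | n + 1 => [] :: D.flatMap fun A => (listsUpTo D n).map (A :: ·)

theorem mem_listsUpTo {D l : List Ty} {n : ℕ} (hl : ∀ A ∈ l, A ∈ D) (hn : l.length ≤ n) :
    l ∈ listsUpTo D n := by
  induction n generalizing l with
  | zero => simp_all [listsUpTo]
  | succ n ih =>
    cases l with
    | nil => simp [listsUpTo]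
    | cons A l =>
      simp only [List.mem_cons, forall_eq_or_imp, List.length_cons] at hl hn
      simp only [listsUpTo, List.mem_cons, List.mem_flatMap, List.mem_map]
      exact .inr ⟨A, hl.1, l, ih hl.2 (by omega), rfl⟩

/-- The type of a variable that takes at most `n` arguments with types in `D`
to results with types in `R`. -/
def varTy (n : ℕ) (D R : List Ty) : Ty :=
  bigInter ((listsUpTo D n).flatMap fun l => R.map (arrows l))

theorem varTy_sub {n : ℕ} {D R l : List Ty} {B : Ty} (hl : ∀ A ∈ l, A ∈ D)
    (hn : l.length ≤ n) (hB : B ∈ R) : Sub (varTy n D R) (arrows l B) :=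
  bigInter_sub <| List.mem_flatMap.2
    ⟨l, mem_listsUpTo hl hn, List.mem_map.2 ⟨B, hB, rfl⟩⟩

/-- The possible types of the arguments of a variable from which all oscillations have
length at most `s`. -/
def argTys (n : ℕ) : ℕ → List Ty
  | 0 => [atom 0]
  | s + 1 => (List.range (n + 1)).map fun k =>
      arrows (List.replicate k (varTy n (argTys n s) [atom 0])) (atom 0)

theorem atom_mem_argTys (n s : ℕ) : atom 0 ∈ argTys n s := by
  cases s with
  | zero => simp [argTys]
  | succ s =>
    simp only [argTys, List.mem_map, List.mem_range]
    exact ⟨0, by omega, rfl⟩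

/-- The types of the last `m` variables of a root prefix of length `n`. -/
def rootTys (n : ℕ) : ℕ → List Ty
  | 0 => []
  | m + 1 => varTy n (argTys n n) ((rootTys n m).tails.map (arrows · (atom 0))) :: rootTys n m

theorem length_rootTys (n m : ℕ) : (rootTys n m).length = m := by
  induction m with
  | zero => rfl
  | succ m ih => simp [rootTys, ih]

theorem exists_varTy_of_mem_take_rootTys {n m k : ℕ} {T : Ty}
    (hT : T ∈ (rootTys n m).take k) :
    ∃ R, T = varTy n (argTys n n) R ∧ atom 0 ∈ R ∧
      arrows ((rootTys n m).drop k) (atom 0) ∈ R := by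
  induction m generalizing k with
  | zero => simp [rootTys] at hT
  | succ m ih =>
    cases k with
    | zero => simp at hT
    | succ k =>
      simp only [rootTys, List.take_succ_cons, List.mem_cons] at hT
      rcases hT with rfl | hT
      · refine ⟨_, rfl, List.mem_map.2 ⟨[], by simp, rfl⟩, List.mem_map.2 ⟨_, ?_, rfl⟩⟩
        simpa [rootTys] using List.drop_suffix _ _
      · exact ih hT

theorem arrows_append (l l' : List Ty) (B : Ty) :
    arrows (l ++ l') B = arrows l (arrows l' B) :=
  List.foldr_append

end Ty

open Term Ty

theorem BCD.sub {Γ : List Ty} {t : Term} {A B : Ty} (h : BCD Γ t A) (hs : Sub A B) :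
    BCD Γ t B :=
  h.map fun d => .sub _ _ _ _ d hs

theorem BCD.app {Γ : List Ty} {s t : Term} {A B : Ty} (hs : BCD Γ s (arrow A B))
    (ht : BCD Γ t A) : BCD Γ (.app s t) B :=
  hs.elim fun d => ht.map fun e => .app _ _ _ _ _ d e

theorem BCD.of_stripPrefix {t : Term} {Γ l : List Ty} {B : Ty} (hl : l.length = prefixLen t)
    (h : BCD (l.reverse ++ Γ) (stripPrefix t) B) : BCD Γ t (arrows l B) := by
  induction t generalizing l Γ with
  | var n =>
    obtain rfl := List.length_eq_zero_iff.1 hl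
    exact h
  | app s t _ _ =>
    obtain rfl := List.length_eq_zero_iff.1 hl
    exact h
  | lam t ih =>
    cases l with
    | nil => simp [prefixLen] at hl
    | cons A l =>
      simp only [List.length_cons, prefixLen, Nat.add_right_cancel_iff] at hl
      exact (ih (Γ := A :: Γ) hl (by simpa [stripPrefix] using h)).map fun d => .lam _ _ _ _ d

theorem BCD.of_spine {t : Term} {Γ l : List Ty} {B : Ty} {n : ℕ} (hn : spineHead t = some n)
    (hv : BCD Γ (.var n) (arrows l B)) (hl : List.Forall₂ (BCD Γ) (spineArgs t) l) :
    BCD Γ t B := by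
  induction t generalizing l B with
  | var m =>
    simp only [spineHead, Option.some.injEq] at hn
    simp only [spineArgs, List.forall₂_nil_left_iff] at hl
    subst hn hl
    exact hv
  | app s t ihs _ =>
    simp only [spineArgs] at hl
    rw [← List.reverse_reverse l, ← List.forall₂_reverse_iff, List.reverse_reverse,
      List.reverse_append] at hl
    obtain ⟨A, l', hA, hl', hrev⟩ := List.forall₂_cons_left_iff.1 hl
    have hl'' : l = l'.reverse ++ [A] := by
      rw [← List.reverse_reverse l, hrev, List.reverse_cons]
    rw [hl'', arrows_append] at hv
    refine (ihs hn hv ?_).app hA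
    rw [← List.forall₂_reverse_iff, List.reverse_reverse]
    exact hl'
  | lam t _ => simp [spineHead] at hn

/-- The type assigned to `i` by `Γ` accepts the arguments at the node `w`, and takes them to `B`
among other results. -/
def Admits (n : ℕ) (Γ : List Ty) (i : ℕ) (w : Term) (B : Ty) : Prop :=
  ∃ s R, Γ[i]? = some (varTy n (argTys n s) R) ∧ B ∈ R ∧ ∀ l, Osc w l → l ≤ s

/-- `Γ`, as a basis for the body of `t`, admits every node of `t` whose head variable is
not bound strictly below the prefix of `t`. -/
def AdmitsNodes (n : ℕ) (Γ : List Ty) (t : Term) : Prop :=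
  ∀ d w h, Desc t d w → headOf w = some h → prefixLen w + d ≤ h + prefixLen t →
    Admits n Γ (h + prefixLen t - (prefixLen w + d)) w (atom 0)

theorem AdmitsNodes.of_mem_argsOf {n : ℕ} {Γ : List Ty} {t u : Term} (h : AdmitsNodes n Γ t)
    (hu : u ∈ argsOf t) {d k : ℕ} {w : Term} (hw : Desc u d w) (hk : headOf w = some k)
    (hd : prefixLen w + d ≤ k) : Admits n Γ (k - (prefixLen w + d)) w (atom 0) := by
  have := h _ w k (.step hu hw) hk (by omega)
  rwa [show k + prefixLen t - (prefixLen w + (prefixLen t + d)) = k - (prefixLen w + d) by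
    omega] at this

theorem BCD.stripPrefix_of_admitsNodes {n : ℕ} {Γ : List Ty} {t : Term} {B : Ty} {h : ℕ}
    (ht : BetaNormal t)
    (hn : ∀ d w, Desc t d w → prefixLen w ≤ n ∧ (argsOf w).length ≤ n)
    (hΓ : AdmitsNodes n Γ t) (hh : headOf t = some h) (hB : Admits n Γ h t B) :
    BCD Γ (stripPrefix t) B := by
  obtain ⟨s, R, hs, hBR, hosc⟩ := hB
  have hargs : ∀ u ∈ argsOf t, ∃ A ∈ argTys n s, BCD Γ u A := by
    intro u hu
    obtain ⟨k, hk⟩ := (ht.of_mem_argsOf hu).exists_headOf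
    have hnu : ∀ d w, Desc u d w → prefixLen w ≤ n ∧ (argsOf w).length ≤ n :=
      fun d w hw => hn _ w (.step hu hw)
    rcases Nat.eq_zero_or_pos (prefixLen u) with hp | hp
    · refine ⟨atom 0, atom_mem_argTys n s, BCD.of_stripPrefix (l := []) hp.symm ?_⟩
      have hΓu : AdmitsNodes n Γ u := by
        intro d w j hw hj hd
        rw [hp, Nat.add_zero] at hd ⊢
        exact hΓ.of_mem_argsOf hu hw hj hd
      refine BCD.stripPrefix_of_admitsNodes (ht.of_mem_argsOf hu) hnu hΓu hk ?_
      simpa [hp] using hΓu 0 u k (.refl u) hk (by omega)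
    · obtain ⟨s, rfl⟩ : ∃ r, s = r + 1 := ⟨s - 1, by have := hosc 1 (.one hu hp); omega⟩
      set V := varTy n (argTys n s) [atom 0] with hV
      refine ⟨arrows (List.replicate (prefixLen u) V) (atom 0), ?_,
        BCD.of_stripPrefix (by simp) ?_⟩
      · simp only [argTys, List.mem_map, List.mem_range]
        exact ⟨prefixLen u, by have := (hnu 0 u (.refl u)).1; omega, rfl⟩
      rw [List.reverse_replicate]
      have hΓu : AdmitsNodes n (List.replicate (prefixLen u) V ++ Γ) u := by
        intro d w j hw hj hd
        rcases Nat.lt_or_ge j (prefixLen w + d) with hlt | hge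
        · refine ⟨s, [atom 0], ?_, by simp, fun l hl => ?_⟩
          · rw [List.getElem?_append_left (by simp; omega), List.getElem?_replicate,
              if_pos (by omega)]
          · have := hosc _ (.succ hu hp hw hj hd hlt hl)
            omega
        · obtain ⟨r, R', hr, hR'⟩ := hΓ.of_mem_argsOf hu hw hj hge
          refine ⟨r, R', ?_, hR'⟩
          rw [List.getElem?_append_right (by simp; omega), List.length_replicate, ← hr]
          congr 1
          omega
      refine BCD.stripPrefix_of_admitsNodes (ht.of_mem_argsOf hu) hnu hΓu hk ?_
      simpa using hΓu 0 u k (.refl u) hk (by omega)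
  have : Inhabited Ty := ⟨atom 0⟩
  choose! f hf hfB using hargs
  refine BCD.of_spine (l := (argsOf t).map f) hh ?_ ?_
  · refine BCD.sub ⟨.var _ _ _ hs⟩ (varTy_sub ?_ ?_ hBR)
    · simpa using hf
    · simpa using (hn 0 t (.refl t)).2
  · rw [List.forall₂_map_right_iff]
    exact List.forall₂_same.2 hfB
termination_by sizeOf t
decreasing_by all_goals exact sizeOf_lt_of_mem_argsOf hu

/-- Class n Theorem: For each `n` there is an intersection type
`A` such that every closed beta-eta normal term `M` of class `n` satisfies
`⊢ M : A` in BCD. -/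
theorem class_n_theorem (n : ℕ) :
    ∃ A : Ty, ∀ M : Term, Term.Closed M → Term.BetaEtaNormal M →
      Term.HasClass n M → BCD [] M A := by
  refine ⟨arrows (rootTys n n) (atom 0), fun M hM hnf hc => ?_⟩
  have hβ : BetaNormal M := fun u hu => hnf u (.inl hu)
  have hp : prefixLen M ≤ n := (hc.1 0 M (.refl M)).1
  have hlen : ((rootTys n n).take (prefixLen M)).length = prefixLen M := by
    simpa [length_rootTys] using hp
  have hlt : ∀ d w h, Desc M d w → headOf w = some h → h < prefixLen w + d := by
    intro d w h hw hh
    have := (ClosedUnder.desc hM hw).stripPrefix.lt_of_spineHead hh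
    omega
  have hroot : ∀ i < prefixLen M, ∀ d w, Desc M d w →
      Admits n ((rootTys n n).take (prefixLen M)).reverse i w (atom 0) ∧
      Admits n ((rootTys n n).take (prefixLen M)).reverse i w
        (arrows ((rootTys n n).drop (prefixLen M)) (atom 0)) := by
    intro i hi d w hw
    have hi' : i < ((rootTys n n).take (prefixLen M)).reverse.length := by
      rwa [List.length_reverse, hlen]
    obtain ⟨R, hR, h0, hB⟩ := exists_varTy_of_mem_take_rootTys
      (List.mem_reverse.1 (List.getElem_mem hi'))
    have hget := List.getElem?_eq_getElem hi'
    rw [hR] at hget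
    exact ⟨⟨n, R, hget, h0, fun l => hc.2 d w l hw⟩, ⟨n, R, hget, hB, fun l => hc.2 d w l hw⟩⟩
  obtain ⟨h, hh⟩ := hβ.exists_headOf
  rw [← List.take_append_drop (prefixLen M) (rootTys n n), arrows_append]
  refine BCD.of_stripPrefix hlen ?_
  rw [List.append_nil]
  refine BCD.stripPrefix_of_admitsNodes hβ hc.1 ?_ hh
    (hroot h (by simpa using hlt 0 M h (.refl M) hh) 0 M (.refl M)).2
  intro d w j hw hj hd
  exact (hroot _ (by have := hlt d w j hw hj; omega) d w hw).1
end
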